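/- Let Σ̂ ∈ ℝ^{m×m} be symmetric, K ∈ ℝ^{m×m} symmetric positive definite, ρ > 0 and 1 ≤ r ≤ m, and suppose the set {Z ∈ ℝ^{m×r} : ZᵀZ = I_r, tr(K⁻¹ZZᵀ) ≤ 2rρ²} is nonempty. Then the optimal value of maximizing tr(Σ̂ Z Zᵀ) over this set equals the optimal value of the semidefinite program maximizing ⟨Σ̂, X⟩ over {X ∈ ℝ^{m×m} : X ⪰ 0, ‖X‖₂ ≤ 1, tr(X) = r, tr(K⁻¹X) ≤ 2rρ²}, and the semidefinite program always admits an optimal solution of rank r (hence of the form ZZᵀ with Z feasible for the first problem). -/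

import Mathlib

open scoped RealInnerProductSpace BigOperators
open Matrix

noncomputable section

/-- The traceless symmetric matrix with entries `a`, `-a` at `(i, i)`, `(j, j)` and `b` at
`(i, j)`, `(j, i)`. -/
def planeTraceless {ι : Type*} [DecidableEq ι] (i j : ι) (a b : ℝ) : Matrix ι ι ℝ :=
  single i i a - single j j a + (single i j b + single j i b)

lemma trace_planeTraceless {ι : Type*} [Fintype ι] [DecidableEq ι] {i j : ι} (hij : i ≠ j)
    (a b : ℝ) : (planeTraceless i j a b).trace = 0 := by
  simp [planeTraceless, trace_add, trace_sub, hij, hij.symm]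

lemma trace_mul_planeTraceless {ι : Type*} [Fintype ι] [DecidableEq ι] (G : Matrix ι ι ℝ)
    (i j : ι) (a b : ℝ) :
    (G * planeTraceless i j a b).trace = (G i i - G j j) * a + (G i j + G j i) * b := by
  simp only [planeTraceless, mul_add, mul_sub, trace_add, trace_sub, trace_mul_single]
  simp
  ring

lemma neg_planeTraceless {ι : Type*} [DecidableEq ι] (i j : ι) (a b : ℝ) :
    -planeTraceless i j a b = planeTraceless i j (-a) (-b) := by
  simp only [planeTraceless, ← single_neg]
  abel

lemma planeTraceless_eq_zero {ι : Type*} [DecidableEq ι] {i j : ι} (hij : i ≠ j) {a b : ℝ}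
    (h : planeTraceless i j a b = 0) : a = 0 ∧ b = 0 := by
  refine ⟨?_, ?_⟩
  · simpa [planeTraceless, hij, hij.symm] using congrFun₂ h i i
  · simpa [planeTraceless, hij, hij.symm] using congrFun₂ h i j

lemma posSemidef_diagonal_add_planeTraceless {ι : Type*} [Fintype ι] [DecidableEq ι] {d : ι → ℝ}
    (hd : ∀ k, 0 ≤ d k) {i j : ι} (hij : i ≠ j) {a b : ℝ} (hi : |a| + |b| ≤ d i)
    (hj : |a| + |b| ≤ d j) : (diagonal d + planeTraceless i j a b).PosSemidef := by
  refine PosSemidef.of_dotProduct_mulVec_nonneg ?_ fun x ↦ ?_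
  · simp only [IsHermitian, conjTranspose_eq_transpose_of_trivial, planeTraceless,
      transpose_add, transpose_sub, diagonal_transpose, transpose_single]
    abel
  · have hquad : star x ⬝ᵥ ((diagonal d + planeTraceless i j a b) *ᵥ x) =
        ∑ k, d k * x k ^ 2 + (a * (x i ^ 2 - x j ^ 2) + 2 * b * (x i * x j)) := by
      simp only [planeTraceless, add_mulVec, sub_mulVec, dotProduct_add, dotProduct_sub,
        single_mulVec, star_trivial]
      have hdiag : x ⬝ᵥ (diagonal d *ᵥ x) = ∑ k, d k * x k ^ 2 :=
        Finset.sum_congr rfl fun k _ ↦ by rw [mulVec_diagonal]; ring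
      rw [hdiag]
      simp [dotProduct, Function.update_apply]
      ring
    have hsum : d i * x i ^ 2 + d j * x j ^ 2 ≤ ∑ k, d k * x k ^ 2 := by
      rw [← Finset.sum_pair (f := fun k ↦ d k * x k ^ 2) hij]
      exact Finset.sum_le_sum_of_subset_of_nonneg (Finset.subset_univ _)
        fun k _ _ ↦ mul_nonneg (hd k) (sq_nonneg _)
    rw [hquad]
    have h₁ : (|a| + |b|) * x i ^ 2 ≤ d i * x i ^ 2 := by gcongr
    have h₂ : (|a| + |b|) * x j ^ 2 ≤ d j * x j ^ 2 := by gcongr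
    have ha : 0 ≤ |a| * (x i ^ 2 + x j ^ 2) + a * (x i ^ 2 - x j ^ 2) := by
      nlinarith [neg_abs_le a, le_abs_self a, sq_nonneg (x i), sq_nonneg (x j)]
    have hb : 0 ≤ |b| * (x i ^ 2 + x j ^ 2) + 2 * b * (x i * x j) := by
      nlinarith [neg_abs_le b, le_abs_self b, sq_nonneg (x i + x j), sq_nonneg (x i - x j)]
    linarith

/-- The matrices `0 ⪯ X ⪯ 1` of trace `r` subject to the linear constraint `tr (A X) ≤ c`. -/
def slicedFantope {ι : Type*} [Fintype ι] [DecidableEq ι] (r : ℕ) (A : Matrix ι ι ℝ) (c : ℝ) :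
    Set (Matrix ι ι ℝ) :=
  {X | X.PosSemidef ∧ (1 - X).PosSemidef ∧ X.trace = r ∧ (A * X).trace ≤ c}

lemma isClosed_setOf_posSemidef {ι : Type*} [Fintype ι] :
    IsClosed {X : Matrix ι ι ℝ | X.PosSemidef} := by
  simp only [posSemidef_iff_dotProduct_mulVec, IsHermitian, Set.ofPred_and, Set.ofPred_forall]
  exact (isClosed_eq (by fun_prop) (by fun_prop)).inter
    (isClosed_iInter fun x ↦ isClosed_le (by fun_prop) (by fun_prop))

lemma Matrix.PosSemidef.abs_apply_le {ι : Type*} [Fintype ι] [DecidableEq ι] {X : Matrix ι ι ℝ}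
    (hX : X.PosSemidef) (i j : ι) : |X i j| ≤ (X i i + X j j) / 2 := by
  have hsymm : X j i = X i j := by simpa using hX.1.apply i j
  have hadd := hX.dotProduct_mulVec_nonneg (Pi.single i 1 + Pi.single j 1)
  have hsub := hX.dotProduct_mulVec_nonneg (Pi.single i 1 - Pi.single j 1)
  simp [mulVec_add, mulVec_sub, add_dotProduct, sub_dotProduct, hsymm] at hadd hsub
  rw [abs_le]
  constructor <;> linarith

lemma isCompact_slicedFantope {ι : Type*} [Fintype ι] [DecidableEq ι] (r : ℕ)
    (A : Matrix ι ι ℝ) (c : ℝ) : IsCompact (slicedFantope r A c) := by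
  have hbox : IsCompact
      (Set.univ.pi fun _ : ι ↦ Set.univ.pi fun _ : ι ↦ Set.Icc (-1 : ℝ) 1) :=
    isCompact_univ_pi fun _ ↦ isCompact_univ_pi fun _ ↦ isCompact_Icc
  refine IsCompact.of_isClosed_subset (X := Matrix ι ι ℝ) hbox ?_ ?_
  · refine isClosed_setOf_posSemidef.inter ((isClosed_setOf_posSemidef.preimage
      (f := fun X : Matrix ι ι ℝ ↦ 1 - X) (by fun_prop)).inter
      (IsClosed.inter (isClosed_eq (f := fun X : Matrix ι ι ℝ ↦ X.trace) (by fun_prop) (by fun_prop))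
        (isClosed_le (f := fun X : Matrix ι ι ℝ ↦ (A * X).trace) (by fun_prop) (by fun_prop))))
  · rintro X ⟨hX, hX', -, -⟩ i - j -
    have hdiag (k : ι) : X k k ≤ 1 := by simpa using hX'.diag_nonneg (i := k)
    rw [Set.mem_Icc, ← abs_le]
    linarith [hX.abs_apply_le i j, hdiag i, hdiag j]

lemma exists_maximizer_mem_extremePoints {ι : Type*} [Fintype ι] [DecidableEq ι]
    {S : Set (Matrix ι ι ℝ)} (hS : IsCompact S) (hne : S.Nonempty) (C : Matrix ι ι ℝ) :
    ∃ X ∈ S.extremePoints ℝ, ∀ Y ∈ S, (C * Y).trace ≤ (C * X).trace := by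
  have : LocallyConvexSpace ℝ (Matrix ι ι ℝ) :=
    inferInstanceAs (LocallyConvexSpace ℝ (ι → ι → ℝ))
  let l : Matrix ι ι ℝ →L[ℝ] ℝ :=
    ⟨traceLinearMap ι ℝ ℝ ∘ₗ LinearMap.mulLeft ℝ C, by
      change Continuous fun X ↦ (C * X).trace
      fun_prop⟩
  have hexp : IsExposed ℝ S (l.toExposed S) := ContinuousLinearMap.toExposed.isExposed
  obtain ⟨X₀, hX₀, hmax⟩ := hS.exists_isMaxOn hne l.continuous.continuousOn
  obtain ⟨X, hX⟩ := (hexp.isCompact hS).extremePoints_nonempty ⟨X₀, hX₀, hmax⟩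
  exact ⟨X, hexp.isExtreme.extremePoints_subset_extremePoints hX, hX.1.2⟩

lemma add_conj_planeTraceless_mem_slicedFantope {ι : Type*} [Fintype ι] [DecidableEq ι] {r : ℕ}
    {A : Matrix ι ι ℝ} {c : ℝ} {U : Matrix ι ι ℝ} (hU : Uᵀ * U = 1) {d : ι → ℝ}
    (hX : U * diagonal d * Uᵀ ∈ slicedFantope r A c)
    (hd : ∀ k, 0 ≤ d k) (hd' : ∀ k, d k ≤ 1) {i j : ι} (hij : i ≠ j) {a b : ℝ}
    (hi : |a| + |b| ≤ d i) (hj : |a| + |b| ≤ d j)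
    (hi' : |a| + |b| ≤ 1 - d i) (hj' : |a| + |b| ≤ 1 - d j)
    (hA : (Uᵀ * A * U * planeTraceless i j a b).trace = 0) :
    U * diagonal d * Uᵀ + U * planeTraceless i j a b * Uᵀ ∈ slicedFantope r A c := by
  have hU' : U * Uᵀ = 1 := mul_eq_one_comm.mp hU
  obtain ⟨-, -, htr, hAX⟩ := hX
  refine ⟨?_, ?_, ?_, ?_⟩
  · rw [← add_mul, ← mul_add]
    simpa using (posSemidef_diagonal_add_planeTraceless hd hij hi hj).mul_mul_conjTranspose_same U
  · have hcomp : (1 : Matrix ι ι ℝ) - (U * diagonal d * Uᵀ + U * planeTraceless i j a b * Uᵀ) =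
        U * (diagonal (fun k ↦ 1 - d k) + planeTraceless i j (-a) (-b)) * Uᵀ := by
      rw [← neg_planeTraceless, ← diagonal_sub, diagonal_one, mul_add, add_mul, mul_sub, sub_mul,
        mul_one, hU', mul_neg, neg_mul]
      abel
    rw [hcomp]
    simpa using (posSemidef_diagonal_add_planeTraceless (fun k ↦ sub_nonneg.2 (hd' k)) hij
      (by simpa using hi') (by simpa using hj')).mul_mul_conjTranspose_same U
  · rw [trace_add, htr, trace_mul_comm, ← mul_assoc, hU, one_mul, trace_planeTraceless hij,
      add_zero]
  · rw [mul_add, trace_add]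
    have hcyc : (A * (U * planeTraceless i j a b * Uᵀ)).trace =
        (Uᵀ * A * U * planeTraceless i j a b).trace := by
      rw [← mul_assoc, trace_mul_comm, ← mul_assoc, ← mul_assoc]
    rw [hcyc, hA, add_zero]
    exact hAX

lemma exists_ne_zero_mul_add_mul_eq_zero (α β : ℝ) {ε : ℝ} (hε : 0 < ε) :
    ∃ a b : ℝ, ¬(a = 0 ∧ b = 0) ∧ α * a + β * b = 0 ∧ |a| + |b| ≤ ε := by
  by_cases h : |α| + |β| = 0
  · refine ⟨ε, 0, fun h' ↦ hε.ne' h'.1, ?_, by simp [abs_of_pos hε]⟩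
    have hα : α = 0 := abs_eq_zero.1 (by linarith [abs_nonneg α, abs_nonneg β])
    simp [hα]
  · have hpos : 0 < |α| + |β| := lt_of_le_of_ne (by positivity) (Ne.symm h)
    have ht : 0 < ε / (|α| + |β|) := div_pos hε hpos
    refine ⟨ε / (|α| + |β|) * β, -(ε / (|α| + |β|) * α), ?_, by ring, ?_⟩
    · rintro ⟨h₁, h₂⟩
      have hβ : β = 0 := by simpa [ht.ne'] using h₁
      have hα : α = 0 := by
        rw [neg_eq_zero] at h₂
        exact (mul_eq_zero.1 h₂).resolve_left ht.ne'
      simp [hα, hβ] at h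
    · rw [abs_neg, abs_mul, abs_mul, abs_of_pos ht, ← mul_add, add_comm |β|,
        div_mul_cancel₀ _ hpos.ne']

/-- An extreme point of the sliced Fantope has at most one eigenvalue in the open unit interval. -/
lemma eq_of_eigenvalues_mem_Ioo {ι : Type*} [Fintype ι] [DecidableEq ι] {r : ℕ}
    {A : Matrix ι ι ℝ} {c : ℝ} {U : Matrix ι ι ℝ} (hU : Uᵀ * U = 1) {d : ι → ℝ}
    (hX : U * diagonal d * Uᵀ ∈ (slicedFantope r A c).extremePoints ℝ)
    (hd : ∀ k, 0 ≤ d k) (hd' : ∀ k, d k ≤ 1) {i j : ι}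
    (hi : d i ∈ Set.Ioo 0 1) (hj : d j ∈ Set.Ioo 0 1) : i = j := by
  by_contra hij
  have hε : 0 < min (min (d i) (d j)) (min (1 - d i) (1 - d j)) := by
    simp [hi.1, hi.2, hj.1, hj.2]
  set G := Uᵀ * A * U with hG
  obtain ⟨a, b, hab, hzero, hle⟩ :=
    exists_ne_zero_mul_add_mul_eq_zero (G i i - G j j) (G i j + G j i) hε
  simp only [le_min_iff] at hle
  obtain ⟨⟨h₁, h₂⟩, h₃, h₄⟩ := hle
  have hadd := add_conj_planeTraceless_mem_slicedFantope hU hX.1 hd hd' hij h₁ h₂ h₃ h₄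
    (by rw [trace_mul_planeTraceless, ← hG, hzero])
  have hsub := add_conj_planeTraceless_mem_slicedFantope hU hX.1 hd hd' hij (a := -a) (b := -b)
    (by simpa using h₁) (by simpa using h₂) (by simpa using h₃) (by simpa using h₄)
    (by rw [trace_mul_planeTraceless, ← hG]; linarith)
  rw [← neg_planeTraceless] at hsub
  have hmid : U * diagonal d * Uᵀ ∈ openSegment ℝ
      (U * diagonal d * Uᵀ + U * planeTraceless i j a b * Uᵀ)
      (U * diagonal d * Uᵀ + U * -planeTraceless i j a b * Uᵀ) := by
    refine ⟨1 / 2, 1 / 2, by norm_num, by norm_num, by norm_num, ?_⟩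
    rw [mul_neg, neg_mul]
    module
  have hD : U * planeTraceless i j a b * Uᵀ = 0 := by
    simpa using hX.2 hadd hsub hmid
  refine hab (planeTraceless_eq_zero hij ?_)
  calc planeTraceless i j a b = Uᵀ * (U * planeTraceless i j a b * Uᵀ) * U := by
        rw [mul_assoc U, ← mul_assoc, hU, one_mul, mul_assoc, hU, mul_one]
    _ = 0 := by rw [hD]; simp

lemma eq_zero_or_one_of_sum_eq_natCast {ι : Type*} [Fintype ι] [DecidableEq ι] {d : ι → ℝ} {r : ℕ}
    (hd : ∀ k, 0 ≤ d k) (hd' : ∀ k, d k ≤ 1) (hsum : ∑ k, d k = r)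
    (huniq : ∀ i j, d i ∈ Set.Ioo 0 1 → d j ∈ Set.Ioo 0 1 → i = j) (k : ι) :
    d k = 0 ∨ d k = 1 := by
  by_contra! hk
  have hkI : d k ∈ Set.Ioo 0 1 := ⟨(hd k).lt_of_ne' hk.1, (hd' k).lt_of_ne hk.2⟩
  have hrest : ∀ l ∈ Finset.univ.erase k, d l = ((if d l = 1 then 1 else 0 : ℤ) : ℝ) := by
    intro l hl
    split_ifs with h
    · simpa using h
    · by_contra h0
      exact Finset.ne_of_mem_erase hl
        (huniq l k ⟨(hd l).lt_of_ne' (by simpa using h0), (hd' l).lt_of_ne h⟩ hkI)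
  rw [← Finset.add_sum_erase _ _ (Finset.mem_univ k), Finset.sum_congr rfl hrest,
    ← Int.cast_sum] at hsum
  set n : ℤ := ∑ l ∈ Finset.univ.erase k, if d l = 1 then 1 else 0
  have hdk : d k = ((r - n : ℤ) : ℝ) := by push_cast; linarith
  rw [hdk] at hkI
  have h0 : 0 < (r : ℤ) - n := by exact_mod_cast hkI.1
  have h1 : (r : ℤ) - n < 1 := by exact_mod_cast hkI.2
  omega

/-- Extreme points of the sliced Fantope are orthogonal projections of rank `r`. -/
lemma exists_orthonormal_factor_of_mem_extremePoints {ι : Type*} [Fintype ι] [DecidableEq ι]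
    {r : ℕ} {A X : Matrix ι ι ℝ} {c : ℝ} (hX : X ∈ (slicedFantope r A c).extremePoints ℝ) :
    ∃ Z : Matrix ι (Fin r) ℝ, Zᵀ * Z = 1 ∧ Z * Zᵀ = X := by
  obtain ⟨hpsd, hpsd', htr, -⟩ := hX.1
  set d := hpsd.1.eigenvalues
  set U : Matrix ι ι ℝ := (hpsd.1.eigenvectorUnitary : unitaryGroup ι ℝ).1
  have hU : Uᵀ * U = 1 := by
    simpa [star_eq_conjTranspose] using Unitary.coe_star_mul_self hpsd.1.eigenvectorUnitary
  have hXU : X = U * diagonal d * Uᵀ := by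
    simpa [Unitary.conjStarAlgAut_apply, star_eq_conjTranspose] using hpsd.1.spectral_theorem
  have hd (k : ι) : 0 ≤ d k := hpsd.eigenvalues_nonneg k
  have hd' (k : ι) : d k ≤ 1 := by
    have hcomp : Uᵀ * (1 - X) * U = diagonal fun k ↦ 1 - d k := by
      rw [← diagonal_sub, diagonal_one, hXU, mul_sub, sub_mul, mul_one, hU]
      simp only [mul_assoc, hU, mul_one]
      rw [← mul_assoc, hU, one_mul]
    have hnonneg := hpsd'.conjTranspose_mul_mul_same U
    rw [conjTranspose_eq_transpose_of_trivial, hcomp, posSemidef_diagonal_iff] at hnonneg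
    linarith [hnonneg k]
  have hsum : ∑ k, d k = r := by
    rw [← htr, hXU, trace_mul_comm, ← mul_assoc, hU, one_mul, trace_diagonal]
  rw [hXU] at hX
  have h01 := eq_zero_or_one_of_sum_eq_natCast hd hd' hsum
    fun i j ↦ eq_of_eigenvalues_mem_Ioo hU hX hd hd'
  have hcard : Fintype.card {k // d k = 1} = r := by
    have hdite : ∀ k ∈ Finset.univ, d k = if d k = 1 then 1 else 0 := fun k _ ↦ by
      rcases h01 k with h | h <;> simp [h]
    rw [Finset.sum_congr rfl hdite, Finset.sum_boole] at hsum
    rw [Fintype.card_subtype]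
    exact_mod_cast hsum
  let e : Fin r ≃ {k // d k = 1} := (Fintype.equivFinOfCardEq hcard).symm
  refine ⟨U.submatrix id fun s ↦ (e s : ι), ?_, ?_⟩
  · ext s t
    have hst := congrFun₂ hU (e s) (e t)
    simp only [mul_apply, transpose_apply] at hst
    simp [mul_apply, hst, one_apply, Subtype.coe_inj]
  · rw [hXU]
    ext p q
    rw [mul_apply, mul_apply]
    simp only [mul_diagonal, transpose_apply, submatrix_apply, id]
    rw [e.sum_comp (fun k : {k // d k = 1} ↦ U p k * U q k),
      ← Finset.sum_subtype (Finset.univ.filter fun k ↦ d k = 1) (by simp)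
        (fun k ↦ U p k * U q k), Finset.sum_filter]
    refine Finset.sum_congr rfl fun k _ ↦ ?_
    rcases h01 k with h | h <;> simp [h]

lemma posSemidef_one_sub_of_norm_toEuclideanCLM_le_one {ι : Type*} [Fintype ι] [DecidableEq ι]
    {X : Matrix ι ι ℝ} (hX : X.IsHermitian) (hnorm : ‖toEuclideanCLM (𝕜 := ℝ) X‖ ≤ 1) :
    (1 - X).PosSemidef := by
  refine PosSemidef.of_dotProduct_mulVec_nonneg (isHermitian_one.sub hX) fun x ↦ ?_
  set y : EuclideanSpace ℝ ι := WithLp.toLp 2 x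
  have hinner : ⟪y, toEuclideanCLM (𝕜 := ℝ) X y⟫ ≤ ⟪y, y⟫ := by
    rw [real_inner_self_eq_norm_mul_norm]
    refine (real_inner_le_norm _ _).trans (mul_le_mul_of_nonneg_left ?_ (norm_nonneg y))
    simpa using (toEuclideanCLM (𝕜 := ℝ) X).le_of_opNorm_le hnorm y
  have hself : ⟪y, y⟫ = x ⬝ᵥ x := by
    simpa using inner_toEuclideanCLM (1 : Matrix ι ι ℝ) y y
  rw [inner_toEuclideanCLM, hself] at hinner
  simpa [sub_mulVec, dotProduct_sub] using hinner

lemma norm_toEuclideanCLM_mul_transpose_le_one {ι κ : Type*} [Fintype ι] [DecidableEq ι]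
    [Fintype κ] [DecidableEq κ] {Z : Matrix ι κ ℝ} (hZ : Zᵀ * Z = 1) :
    ‖toEuclideanCLM (𝕜 := ℝ) (Z * Zᵀ)‖ ≤ 1 := by
  have hproj : IsStarProjection (Z * Zᵀ) := by
    refine ⟨?_, ?_⟩
    · rw [IsIdempotentElem, Matrix.mul_assoc, ← Matrix.mul_assoc Zᵀ, hZ, Matrix.one_mul]
    · simp [IsSelfAdjoint, star_eq_conjTranspose]
  exact (hproj.map (toEuclideanCLM (𝕜 := ℝ))).norm_le

lemma rank_mul_transpose_of_transpose_mul_eq_one {ι κ : Type*} [Fintype ι] [Fintype κ]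
    [DecidableEq κ] {Z : Matrix ι κ ℝ} (hZ : Zᵀ * Z = 1) : (Z * Zᵀ).rank = Fintype.card κ := by
  rw [rank_self_mul_transpose, ← rank_transpose_mul_self, hZ, rank_one]

/-- Lemma 4 of the paper: SDP reformulation of the `M`-estimator.
Let `Σ̂` be symmetric, `K` symmetric positive definite, `ρ > 0`, `1 ≤ r ≤ m`, and suppose
the Stiefel feasible set `{Z : ZᵀZ = I, tr(K⁻¹ Z Zᵀ) ≤ 2rρ²}` is nonempty.  Then there is a
`Z` feasible for the Stiefel problem such that `X = Z Zᵀ` (which is PSD of rank `r`) is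
optimal for the SDP `max ⟨Σ̂, X⟩ s.t. X ⪰ 0, ‖X‖₂ ≤ 1, tr X = r, tr(K⁻¹X) ≤ 2rρ²`, and
`Z` is simultaneously optimal for the Stiefel problem; in particular the two optimal values
coincide and the SDP has a rank-`r` optimal solution. -/
theorem sampled_fpca_sdp_equivalence
    {m r : ℕ} (hr : 1 ≤ r) (hrm : r ≤ m)
    (Sig K : Matrix (Fin m) (Fin m) ℝ)
    (hSig : Sigᵀ = Sig) (hKpd : K.PosDef) (ρ : ℝ) (hρ : 0 < ρ)
    (hfeas : ∃ Z : Matrix (Fin m) (Fin r) ℝ,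
      Zᵀ * Z = 1 ∧ Matrix.trace (K⁻¹ * (Z * Zᵀ)) ≤ 2 * r * ρ^2) :
    ∃ Z : Matrix (Fin m) (Fin r) ℝ,
      (Zᵀ * Z = 1 ∧ Matrix.trace (K⁻¹ * (Z * Zᵀ)) ≤ 2 * r * ρ^2) ∧
      (Z * Zᵀ).rank = r ∧
      IsGreatest { v : ℝ | ∃ Z' : Matrix (Fin m) (Fin r) ℝ,
          Z'ᵀ * Z' = 1 ∧ Matrix.trace (K⁻¹ * (Z' * Z'ᵀ)) ≤ 2 * r * ρ^2 ∧
          v = Matrix.trace (Sig * (Z' * Z'ᵀ)) }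
        (Matrix.trace (Sig * (Z * Zᵀ))) ∧
      IsGreatest { v : ℝ | ∃ X : Matrix (Fin m) (Fin m) ℝ,
          X.PosSemidef ∧ ‖Matrix.toEuclideanCLM (𝕜 := ℝ) X‖ ≤ 1 ∧
          Matrix.trace X = r ∧ Matrix.trace (K⁻¹ * X) ≤ 2 * r * ρ^2 ∧
          v = Matrix.trace (Sigᵀ * X) }
        (Matrix.trace (Sig * (Z * Zᵀ))) := by
  have hmem {Z : Matrix (Fin m) (Fin r) ℝ} (hZ : Zᵀ * Z = 1)
      (hKZ : (K⁻¹ * (Z * Zᵀ)).trace ≤ 2 * r * ρ ^ 2) :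
      Z * Zᵀ ∈ slicedFantope r K⁻¹ (2 * r * ρ ^ 2) := by
    have hpsd : (Z * Zᵀ).PosSemidef := by simpa using posSemidef_self_mul_conjTranspose Z
    refine ⟨hpsd, posSemidef_one_sub_of_norm_toEuclideanCLM_le_one hpsd.1
      (norm_toEuclideanCLM_mul_transpose_le_one hZ), ?_, hKZ⟩
    rw [trace_mul_comm, hZ]
    simp
  obtain ⟨Z₀, hZ₀, hKZ₀⟩ := hfeas
  obtain ⟨X, hX, hmax⟩ := exists_maximizer_mem_extremePoints
    (isCompact_slicedFantope r K⁻¹ (2 * r * ρ ^ 2)) ⟨_, hmem hZ₀ hKZ₀⟩ Sig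
  obtain ⟨Z, hZ, rfl⟩ := exists_orthonormal_factor_of_mem_extremePoints hX
  obtain ⟨hpsd, -, htr, hKZ⟩ := hX.1
  refine ⟨Z, ⟨hZ, hKZ⟩, by simpa using rank_mul_transpose_of_transpose_mul_eq_one hZ,
    ⟨⟨Z, hZ, hKZ, rfl⟩, ?_⟩,
    ⟨⟨Z * Zᵀ, hpsd, norm_toEuclideanCLM_mul_transpose_le_one hZ, htr, hKZ, by rw [hSig]⟩, ?_⟩⟩
  · rintro _ ⟨Z', hZ', hKZ', rfl⟩
    exact hmax _ (hmem hZ' hKZ')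
  · rintro _ ⟨Y, hY, hnorm, htrY, hKY, rfl⟩
    rw [hSig]
    exact hmax Y ⟨hY, posSemidef_one_sub_of_norm_toEuclideanCLM_le_one hY.1 hnorm, htrY, hKY⟩
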